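/- Let f be N times continuously differentiable on [a,b]. Then for all i, k ∈ ℕ and all 0 ≤ j ≤ N, the shifted moment m̂_{i,j,k} equals the (i+k)-th moment of the function (x−a)^N (x−b)^N f^{(j)}(x); that is, Σ_{t=0}^{2N} δ_t (−1)^j (i+k+t)_j · m_{k+t+i−j} = ∫_a^b x^{i+k} (x−a)^N (x−b)^N f^{(j)}(x) dx. -/

import Mathlib

open Finset intervalIntegral Polynomial

/-- The falling factorial `(x)_j = x(x−1)⋯(x−j+1)`, with `(x)_0 = 1`. -/
noncomputable def fallingFactorial (x : ℝ) (j : ℕ) : ℝ :=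
  ∏ l ∈ Finset.range j, (x - l)

/-- The shifted moment sequence
`m̂_{i,j,k} = Σ_{t=0}^{2N} δ_t (−1)^j (i+k+t)_j m_{k+t+i−j}`, where `δ_t` is the
coefficient of `X^t` in `((X−a)(X−b))^N` and `m` is an (extended) moment sequence. -/
noncomputable def shiftedMoment (a b : ℝ) (N : ℕ) (m : ℤ → ℝ) (i j k : ℕ) : ℝ :=
  ∑ t ∈ Finset.range (2 * N + 1),
    (((Polynomial.X - Polynomial.C a) * (Polynomial.X - Polynomial.C b)) ^ N).coeff t *
      (-1) ^ j * fallingFactorial ((i : ℝ) + k + t) j * m ((k : ℤ) + t + i - j)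

theorem fallingFactorial_natCast (n j : ℕ) :
    fallingFactorial (n : ℝ) j = (n.descFactorial j : ℝ) := by
  rw [fallingFactorial, ← descPochhammer_eval_eq_descFactorial, descPochhammer_eval_eq_prod_range]

/-- Integration by parts, with vanishing boundary terms, against a polynomial that is divisible by
`((X - a) * (X - b)) ^ j`. -/
theorem integral_eval_mul_iteratedDerivWithin {a b : ℝ} (hab : a < b) {N : ℕ} {f : ℝ → ℝ}
    (hf : ContDiffOn ℝ (N : ℕ) f (Set.Icc a b)) {j : ℕ} (hj : j ≤ N) {p : ℝ[X]}
    (hp : ((X - C a) * (X - C b)) ^ j ∣ p) :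
    ∫ x in a..b, p.eval x * iteratedDerivWithin j f (Set.Icc a b) x
      = (-1) ^ j * ∫ x in a..b, (derivative^[j] p).eval x * f x := by
  induction j generalizing p with
  | zero => simp
  | succ j ih =>
    have hu : UniqueDiffOn ℝ (Set.Icc a b) := uniqueDiffOn_Icc hab
    have huIcc : Set.uIcc a b = Set.Icc a b := Set.uIcc_of_le hab.le
    have hcont : ∀ l ≤ N, ContinuousOn (iteratedDerivWithin l f (Set.Icc a b)) (Set.Icc a b) :=
      fun l hl => hf.continuousOn_iteratedDerivWithin (by exact_mod_cast hl) hu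
    have hdvd : (X - C a) * (X - C b) ∣ p := (dvd_pow_self _ j.succ_ne_zero).trans hp
    have hpa : p.eval a = 0 := dvd_iff_isRoot.mp ((dvd_mul_right _ _).trans hdvd)
    have hpb : p.eval b = 0 := dvd_iff_isRoot.mp ((dvd_mul_left _ _).trans hdvd)
    have hparts := integral_mul_deriv_eq_deriv_mul_of_hasDerivAt (a := a) (b := b)
      (u := fun x => p.eval x) (u' := fun x => (derivative p).eval x)
      (v := iteratedDerivWithin j f (Set.Icc a b))
      (v' := iteratedDerivWithin (j + 1) f (Set.Icc a b))
      p.continuous.continuousOn (by rw [huIcc]; exact hcont j (by omega))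
      (fun x _ => p.hasDerivAt x)
      (fun x hx => by
        rw [min_eq_left hab.le, max_eq_right hab.le] at hx
        rw [iteratedDerivWithin_succ]
        exact ((hf.differentiableOn_iteratedDerivWithin (by exact_mod_cast hj) hu) x
          (Set.Ioo_subset_Icc_self hx)).hasDerivWithinAt.hasDerivAt (Icc_mem_nhds hx.1 hx.2))
      ((derivative p).continuous.intervalIntegrable _ _)
      (ContinuousOn.intervalIntegrable (by rw [huIcc]; exact hcont (j + 1) hj))
    have hp' : ((X - C a) * (X - C b)) ^ j ∣ derivative p := by
      simpa using pow_sub_one_dvd_derivative_of_pow_dvd hp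
    rw [hparts, ih (by omega) hp', hpa, hpb, Function.iterate_succ_apply]
    ring

theorem pow_mul_eq_sum_monomials (a b : ℝ) (N n : ℕ) :
    X ^ n * ((X - C a) * (X - C b)) ^ N = ∑ t ∈ Finset.range (2 * N + 1),
      C ((((X - C a) * (X - C b)) ^ N).coeff t) * X ^ (n + t) := by
  have hdeg : (((X - C a) * (X - C b)) ^ N).natDegree < 2 * N + 1 := by
    have h : ((X - C a) * (X - C b)).natDegree ≤ 2 :=
      natDegree_mul_le.trans (by simp)
    have := natDegree_pow_le_of_le N h
    omega
  conv_lhs => rw [as_sum_range_C_mul_X_pow' _ hdeg, Finset.mul_sum]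
  exact Finset.sum_congr rfl fun t _ => by ring

theorem shifted_moment_eq_moment_of_derivative (a b : ℝ) (hab : a < b)
    (N : ℕ) (hN : 1 ≤ N) (f : ℝ → ℝ)
    (hf : ContDiffOn ℝ (N : ℕ) f (Set.Icc a b))
    (m : ℤ → ℝ)
    (hm : ∀ k : ℕ, m k = ∫ x in a..b, x ^ k * f x)
    (hm0 : ∀ k : ℤ, k < 0 → m k = 0) :
    ∀ (i k : ℕ), ∀ j ≤ N,
      shiftedMoment a b N m i j k
        = ∫ x in a..b, x ^ (i + k) * (x - a) ^ N * (x - b) ^ N *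
            iteratedDerivWithin j f (Set.Icc a b) x := by
  intro i k j hj
  have hparts := integral_eval_mul_iteratedDerivWithin hab hf hj
    (p := X ^ (i + k) * ((X - C a) * (X - C b)) ^ N)
    ((pow_dvd_pow _ hj).trans (dvd_mul_left _ _))
  have hint : ∀ n : ℕ, IntervalIntegrable (fun x => x ^ n * f x) MeasureTheory.volume a b :=
    fun n => ContinuousOn.intervalIntegrable <| by
      rw [Set.uIcc_of_le hab.le]
      exact (continuous_pow n).continuousOn.mul hf.continuousOn
  calc shiftedMoment a b N m i j k
      = (-1) ^ j * ∫ x in a..b,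
          (derivative^[j] (X ^ (i + k) * ((X - C a) * (X - C b)) ^ N)).eval x * f x := by
        simp only [pow_mul_eq_sum_monomials, iterate_derivative_sum, iterate_derivative_C_mul,
          iterate_derivative_X_pow_eq_natCast_mul, eval_finsetSum, eval_mul, eval_C, eval_natCast,
          eval_pow, eval_X, Finset.sum_mul, mul_assoc]
        rw [integral_finsetSum fun t _ => ((hint _).const_mul _).const_mul _, Finset.mul_sum,
          shiftedMoment]
        refine Finset.sum_congr rfl fun t _ => ?_
        rw [integral_const_mul, integral_const_mul, ← hm,
          show (i : ℝ) + k + t = ((i + k + t : ℕ) : ℝ) by push_cast; ring,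
          fallingFactorial_natCast]
        rcases lt_or_ge (i + k + t) j with h | h
        · simp [Nat.descFactorial_of_lt h]
        · rw [show (k : ℤ) + t + i - j = ((i + k + t - j : ℕ) : ℤ) by omega]
          ring
    _ = _ := by
        rw [← hparts]
        refine integral_congr fun x _ => ?_
        simp [mul_pow, mul_assoc]
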